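/- The A_k-module R_{j,Δ,ω} has finite length with at most four composition factors. If R_{j,Δ,ω} is not simple, then one of its composition factors is an infinite-dimensional highest-weight A_k-module, another is an infinite-dimensional lowest-weight A_k-module, and any remaining composition factors are finite-dimensional. -/

import Mathlib

noncomputable section

namespace BP

/-- The free `ℂ`-algebra on four generators `J, G⁺, G⁻, L`. -/
abbrev F : Type := FreeAlgebra ℂ (Fin 4)

def jF : F := FreeAlgebra.ι ℂ 0
def gpF : F := FreeAlgebra.ι ℂ 1
def gmF : F := FreeAlgebra.ι ℂ 2
def lF : F := FreeAlgebra.ι ℂ 3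

/-- `f_k(J, L) = 3J² − (k+3)L − (1/8)(k+1)(2k+3)·1`, as an element of the free algebra. -/
def fF (k : ℂ) : F :=
  3 * jF ^ 2 - algebraMap ℂ F (k + 3) * lF - algebraMap ℂ F (1/8 * (k + 1) * (2*k + 3))

/-- The defining relations of `A_k`: `L` is central, `[J,G⁺] = G⁺`, `[J,G⁻] = −G⁻`,
`[G⁺,G⁻] = f_k(J,L)`. -/
inductive Rel (k : ℂ) : F → F → Prop
  | lj : Rel k (lF * jF) (jF * lF)
  | lgp : Rel k (lF * gpF) (gpF * lF)
  | lgm : Rel k (lF * gmF) (gmF * lF)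
  | jgp : Rel k (jF * gpF - gpF * jF) gpF
  | jgm : Rel k (jF * gmF - gmF * jF) (-gmF)
  | gpgm : Rel k (gpF * gmF - gmF * gpF) (fF k)

/-- The unital associative `ℂ`-algebra `A_k`: the quotient of the free algebra on
`J, G⁺, G⁻, L` by the two-sided ideal generated by the defining relations. -/
def A (k : ℂ) : Type := RingQuot (Rel k)

instance (k : ℂ) : Ring (A k) := inferInstanceAs (Ring (RingQuot (Rel k)))
instance (k : ℂ) : Algebra ℂ (A k) := inferInstanceAs (Algebra ℂ (RingQuot (Rel k)))

/-- The quotient map `F →ₐ[ℂ] A_k`. -/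
def mk (k : ℂ) : F →ₐ[ℂ] A k := RingQuot.mkAlgHom ℂ (Rel k)

/-- The generator `J` of `A_k`. -/
def J (k : ℂ) : A k := mk k jF
/-- The generator `G⁺` of `A_k`. -/
def Gp (k : ℂ) : A k := mk k gpF
/-- The generator `G⁻` of `A_k`. -/
def Gm (k : ℂ) : A k := mk k gmF
/-- The generator `L` of `A_k`. -/
def L (k : ℂ) : A k := mk k lF

/-- The central element `Ω = G⁺G⁻ + G⁻G⁺ + 2J³ + J − 2J((k+3)L + (1/8)(k+1)(2k+3)·1)`. -/
def Omega (k : ℂ) : A k :=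
  Gp k * Gm k + Gm k * Gp k + 2 * J k ^ 3 + J k
    - 2 * J k * (algebraMap ℂ (A k) (k + 3) * L k
        + algebraMap ℂ (A k) (1/8 * (k + 1) * (2*k + 3)))

/-- The left ideal of `A_k` by which one quotients to obtain the induced module
`R_{j,Δ,ω} = A_k ⊗_{C_k} ℂ_{j,Δ,ω}`: it is generated by `J − j·1`, `L − Δ·1` and
`Ω − ω·1`. -/
def denseIdeal (k j Δ ω : ℂ) : Submodule (A k) (A k) :=
  Submodule.span (A k)
    {J k - algebraMap ℂ (A k) j, L k - algebraMap ℂ (A k) Δ,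
      Omega k - algebraMap ℂ (A k) ω}

/-- The induced module `R_{j,Δ,ω} = A_k ⊗_{C_k} ℂ_{j,Δ,ω}`, realised as the quotient
`A_k / A_k·(J−j, L−Δ, Ω−ω)`. -/
abbrev Rmod (k j Δ ω : ℂ) : Type := A k ⧸ denseIdeal k j Δ ω

/-- The generating vector `v = 1 ⊗ 1` of `R_{j,Δ,ω}`. -/
def rv (k j Δ ω : ℂ) : Rmod k j Δ ω := Submodule.Quotient.mk (1 : A k)

/-- `ω⁺_{j,Δ} = (2j+1)(j(j+1) − (k+3)Δ − (1/8)(k+1)(2k+3))`. -/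
def omegaP (k j Δ : ℂ) : ℂ :=
  (2*j + 1) * (j*(j + 1) - (k + 3)*Δ - 1/8 * (k + 1) * (2*k + 3))

/-- `ω⁻_{j,Δ} = (2j−1)(j(j−1) − (k+3)Δ − (1/8)(k+1)(2k+3))`. -/
def omegaM (k j Δ : ℂ) : ℂ :=
  (2*j - 1) * (j*(j - 1) - (k + 3)*Δ - 1/8 * (k + 1) * (2*k + 3))

/-- A highest-weight `A_k`-module: one generated by a simultaneous eigenvector of `J`
and `L` that is annihilated by `G⁺`. -/
def IsHWModule (k : ℂ) (M : Type) [AddCommGroup M] [Module (A k) M] : Prop :=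
  ∃ (m : M) (j Δ : ℂ), m ≠ 0 ∧ J k • m = algebraMap ℂ (A k) j • m ∧
    L k • m = algebraMap ℂ (A k) Δ • m ∧ Gp k • m = 0 ∧
    Submodule.span (A k) {m} = ⊤

/-- A lowest-weight `A_k`-module: one generated by a simultaneous eigenvector of `J`
and `L` that is annihilated by `G⁻`. -/
def IsLWModule (k : ℂ) (M : Type) [AddCommGroup M] [Module (A k) M] : Prop :=
  ∃ (m : M) (j Δ : ℂ), m ≠ 0 ∧ J k • m = algebraMap ℂ (A k) j • m ∧
    L k • m = algebraMap ℂ (A k) Δ • m ∧ Gm k • m = 0 ∧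
    Submodule.span (A k) {m} = ⊤

/-- The factor module `P / N` associated to a pair of submodules `N ≤ P` of an
`A_k`-module. -/
abbrev factorModule (k : ℂ) {M : Type} [AddCommGroup M] [Module (A k) M]
    (N P : Submodule (A k) M) : Type :=
  P ⧸ N.comap P.subtype

/-- Finite-dimensionality over `ℂ` of an `A_k`-module (the `ℂ`-action being obtained by
restricting the `A_k`-action along `algebraMap ℂ (A k)`). -/
def FinDimOverC (k : ℂ) (M : Type) [AddCommGroup M] [Module (A k) M] : Prop :=
  letI : Module ℂ M := Module.compHom M (algebraMap ℂ (A k))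
  Module.Finite ℂ M

section Ranks

/-- The number of elements of `N` strictly below `n`. -/
def rank (N : Finset ℤ) (n : ℤ) : ℕ := (N.filter (· < n)).card

lemma rank_mono (N : Finset ℤ) : Monotone (rank N) := fun _ _ h =>
  Finset.card_le_card fun _ hx => by
    simp only [Finset.mem_filter] at hx ⊢
    exact ⟨hx.1, hx.2.trans_le h⟩

lemma rank_le_card (N : Finset ℤ) (n : ℤ) : rank N n ≤ N.card := Finset.card_filter_le _ _

lemma rank_succ_of_mem {N : Finset ℤ} {n : ℤ} (h : n ∈ N) : rank N (n + 1) = rank N n + 1 := by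
  have : N.filter (· < n + 1) = insert n (N.filter (· < n)) := by
    ext x
    simp only [Finset.mem_filter, Finset.mem_insert]
    constructor
    · rintro ⟨hx, hlt⟩
      rcases (Int.lt_add_one_iff.mp hlt).lt_or_eq with h' | h'
      · exact Or.inr ⟨hx, h'⟩
      · exact Or.inl h'
    · rintro (rfl | ⟨hx, hlt⟩)
      · exact ⟨h, by omega⟩
      · exact ⟨hx, by omega⟩
  rw [rank, this, Finset.card_insert_of_notMem (by simp), rank]

lemma rank_succ_of_notMem {N : Finset ℤ} {n : ℤ} (h : n ∉ N) : rank N (n + 1) = rank N n := by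
  refine congrArg Finset.card (Finset.filter_congr fun x hx => ?_)
  have : x ≠ n := fun e => h (e ▸ hx)
  omega

lemma rank_succ_le (N : Finset ℤ) (n : ℤ) : rank N (n + 1) ≤ rank N n + 1 := by
  by_cases h : n ∈ N
  · exact (rank_succ_of_mem h).le
  · exact (rank_succ_of_notMem h).le.trans (Nat.le_succ _)

lemma rank_eq_zero_of_forall_le {N : Finset ℤ} {n : ℤ} (h : ∀ x ∈ N, n ≤ x) : rank N n = 0 := by
  rw [rank, Finset.card_eq_zero, Finset.filter_eq_empty_iff]
  exact fun x hx => not_lt.mpr (h x hx)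

lemma rank_eq_card_of_forall_lt {N : Finset ℤ} {n : ℤ} (h : ∀ x ∈ N, x < n) :
    rank N n = N.card := by
  rw [rank, Finset.filter_true_of_mem h]

lemma exists_rank_eq (N : Finset ℤ) {i : ℕ} (hi : i ≤ N.card) : ∃ n, rank N n = i := by
  obtain ⟨l, hl⟩ := N.bddBelow
  obtain ⟨u, hu⟩ := N.bddAbove
  have h0 : rank N l = 0 := rank_eq_zero_of_forall_le fun x hx => hl hx
  have hex : ∃ t : ℕ, i ≤ rank N (l + t) := by
    refine ⟨(u + 1 - l).toNat, ?_⟩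
    rw [rank_eq_card_of_forall_lt fun x hx => ?_]
    · exact hi
    · have := hu (Finset.mem_coe.mpr hx)
      omega
  classical
  refine ⟨l + Nat.find hex, le_antisymm ?_ (Nat.find_spec hex)⟩
  rcases hfind : Nat.find hex with _ | t
  · simp [h0]
  · have h1 := Nat.find_min hex (m := t) (by omega)
    have h2 := rank_succ_le N (l + t)
    push_cast
    rw [← add_assoc]
    omega

lemma notMem_of_rank_eq {N : Finset ℤ} {m n t : ℤ} (h : rank N m = rank N n) (hmt : m ≤ t)
    (htn : t < n) : t ∉ N := fun ht => by
  have h1 := rank_mono N hmt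
  have h2 := rank_succ_of_mem ht
  have h3 := rank_mono N (show t + 1 ≤ n by omega)
  omega

/-- A renumbering of the blocks of `ℤ` cut out by `N`: first the blocks to the left of the one
containing `0`, from left to right, then the remaining ones, from right to left. -/
def level (N : Finset ℤ) (n : ℤ) : ℕ :=
  if rank N n < rank N 0 then rank N n else rank N 0 + N.card - rank N n

lemma level_lt (N : Finset ℤ) (n : ℤ) : level N n < N.card + 1 := by
  have h1 := rank_le_card N n
  have h2 := rank_le_card N 0
  unfold level
  split_ifs <;> omega

lemma level_eq_iff (N : Finset ℤ) (m n : ℤ) : level N m = level N n ↔ rank N m = rank N n := by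
  have h1 := rank_le_card N n
  have h2 := rank_le_card N 0
  have h3 := rank_le_card N m
  unfold level
  split_ifs <;> omega

lemma exists_level_eq (N : Finset ℤ) {i : ℕ} (hi : i < N.card + 1) : ∃ n, level N n = i := by
  have h2 := rank_le_card N 0
  by_cases h : i < rank N 0
  · obtain ⟨n, hn⟩ := exists_rank_eq N (i := i) (by omega)
    exact ⟨n, by rw [level, if_pos (by omega), hn]⟩
  · obtain ⟨n, hn⟩ := exists_rank_eq N (i := rank N 0 + N.card - i) (by omega)
    exact ⟨n, by rw [level, if_neg (by omega), hn]; omega⟩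

lemma level_succ_le {N : Finset ℤ} {n : ℤ} (h : ¬ (n ∈ N ∧ n < 0)) :
    level N (n + 1) ≤ level N n := by
  by_cases hn : n ∈ N
  · have h0 : 0 ≤ n := not_lt.mp fun h' => h ⟨hn, h'⟩
    have h1 := rank_mono N h0
    have h2 := rank_succ_of_mem hn
    unfold level
    split_ifs <;> omega
  · exact ((level_eq_iff N _ _).mpr (rank_succ_of_notMem hn)).le

lemma level_le_succ {N : Finset ℤ} {n : ℤ} (h : ¬ (n ∈ N ∧ 0 ≤ n)) :
    level N n ≤ level N (n + 1) := by
  by_cases hn : n ∈ N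
  · have h0 : n < 0 := not_le.mp fun h' => h ⟨hn, h'⟩
    have h1 := rank_mono N (show n + 1 ≤ 0 by omega)
    have h2 := rank_succ_of_mem hn
    have h3 := rank_le_card N (n + 1)
    unfold level
    split_ifs <;> omega
  · exact ((level_eq_iff N _ _).mpr (rank_succ_of_notMem hn)).ge

end Ranks

section Algebra

variable {k : ℂ}

lemma Gp_mul_Gm : Gp k * Gm k - Gm k * Gp k = 3 * J k ^ 2 - algebraMap ℂ (A k) (k + 3) * L k
    - algebraMap ℂ (A k) (1/8 * (k + 1) * (2*k + 3)) := by
  have h := RingQuot.mkAlgHom_rel ℂ (Rel.gpgm (k := k))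
  rw [fF, map_sub, map_sub, map_sub, map_mul, map_mul, map_mul, map_mul, map_pow, AlgHom.commutes,
    AlgHom.commutes, map_ofNat] at h
  exact h

lemma J_mul_Gp : J k * Gp k = Gp k * J k + Gp k := by
  have h := RingQuot.mkAlgHom_rel ℂ (Rel.jgp (k := k))
  simp only [map_sub, map_mul] at h
  exact sub_eq_iff_eq_add'.mp h

lemma J_mul_Gm : J k * Gm k = Gm k * J k - Gm k := by
  have h := RingQuot.mkAlgHom_rel ℂ (Rel.jgm (k := k))
  simp only [map_sub, map_mul, map_neg] at h
  rw [sub_eq_add_neg]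
  exact sub_eq_iff_eq_add'.mp h

lemma L_mul_Gp : L k * Gp k = Gp k * L k := by
  have h := RingQuot.mkAlgHom_rel ℂ (Rel.lgp (k := k))
  simp only [map_mul] at h
  exact h

lemma L_mul_Gm : L k * Gm k = Gm k * L k := by
  have h := RingQuot.mkAlgHom_rel ℂ (Rel.lgm (k := k))
  simp only [map_mul] at h
  exact h

/-- `A_k` is generated as an algebra by `J, G⁺, G⁻, L`. -/
lemma A_induction {p : A k → Prop} (hc : ∀ c, p (algebraMap ℂ (A k) c)) (hJ : p (J k))
    (hGp : p (Gp k)) (hGm : p (Gm k)) (hL : p (L k)) (hmul : ∀ x y, p x → p y → p (x * y))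
    (hadd : ∀ x y, p x → p y → p (x + y)) (x : A k) : p x := by
  obtain ⟨y, rfl⟩ := RingQuot.mkAlgHom_surjective ℂ (Rel k) x
  change p (mk k y)
  induction y using FreeAlgebra.induction with
  | grade0 c => rw [AlgHom.commutes]; exact hc c
  | grade1 i => fin_cases i <;> assumption
  | mul x y hx hy => rw [map_mul]; exact hmul _ _ hx hy
  | add x y hx hy => rw [map_add]; exact hadd _ _ hx hy

variable {M : Type} [AddCommGroup M] [Module (A k) M] [Module ℂ M] [IsScalarTower ℂ (A k) M]

lemma smul_mem_of_generators (P : Submodule ℂ M) (hJ : ∀ x ∈ P, J k • x ∈ P)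
    (hGp : ∀ x ∈ P, Gp k • x ∈ P) (hGm : ∀ x ∈ P, Gm k • x ∈ P) (hL : ∀ x ∈ P, L k • x ∈ P)
    (c : A k) : ∀ x ∈ P, c • x ∈ P := by
  induction c using A_induction with
  | hc c => exact fun x hx => by rw [algebraMap_smul]; exact P.smul_mem c hx
  | hmul a b ha hb => exact fun x hx => by rw [mul_smul]; exact ha _ (hb _ hx)
  | hadd a b ha hb => exact fun x hx => by rw [add_smul]; exact P.add_mem (ha _ hx) (hb _ hx)
  | _ => assumption

lemma finDimOverC_iff : FinDimOverC k M ↔ Module.Finite ℂ M := by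
  have : Module.compHom M (algebraMap ℂ (A k)) = ‹Module ℂ M› := by
    refine Module.ext' _ _ fun r x => ?_
    exact algebraMap_smul (A k) r x
  rw [FinDimOverC, this]

end Algebra

/-- A basis of weight vectors, indexed by `ℤ`, on which `G⁺` and `G⁻` act as weighted shifts. -/
structure WeightBasis (k : ℂ) (M : Type) [AddCommGroup M] [Module (A k) M] [Module ℂ M] where
  /-- the basis -/
  B : Module.Basis ℤ ℂ M
  /-- matrix coefficients of `G⁺` -/
  a : ℤ → ℂ
  /-- matrix coefficients of `G⁻` -/
  b : ℤ → ℂ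
  /-- the weight of `B 0` -/
  j : ℂ
  /-- the eigenvalue of `L` -/
  Δ : ℂ
  J_smul : ∀ n, J k • B n = (j + n) • B n
  L_smul : ∀ n, L k • B n = Δ • B n
  Gp_smul : ∀ n, Gp k • B n = a n • B (n + 1)
  Gm_smul : ∀ n, Gm k • B (n + 1) = b n • B n

namespace WeightBasis

variable {k : ℂ} {M : Type} [AddCommGroup M] [Module (A k) M] [Module ℂ M]
  [IsScalarTower ℂ (A k) M] (W : WeightBasis k M)

lemma aeval_J_smul (p : Polynomial ℂ) (n : ℤ) :
    Polynomial.aeval (J k) p • W.B n = p.eval (W.j + n) • W.B n := by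
  have : SMulCommClass ℂ (A k) M := IsScalarTower.to_smulCommClass
  induction p using Polynomial.induction_on' with
  | add p q hp hq => rw [map_add, add_smul, hp, hq, Polynomial.eval_add, add_smul]
  | monomial m c =>
    rw [Polynomial.aeval_monomial, mul_smul, algebraMap_smul, Polynomial.eval_monomial, mul_smul]
    congr 1
    induction m with
    | zero => simp
    | succ m ih =>
      rw [pow_succ, mul_smul, W.J_smul, smul_comm, ih, smul_smul, pow_succ, mul_comm]

/-- Submodules are spanned by weight vectors. -/
lemma basis_mem_of_mem {P : Submodule (A k) M} {x : M} (hx : x ∈ P) {n : ℤ}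
    (hn : W.B.repr x n ≠ 0) : W.B n ∈ P := by
  have : SMulCommClass ℂ (A k) M := IsScalarTower.to_smulCommClass
  set S := (W.B.repr x).support
  set p : Polynomial ℂ := ∏ m ∈ S.erase n, (Polynomial.X - Polynomial.C (W.j + m))
  have hp : p.eval (W.j + n) ≠ 0 := by
    rw [Polynomial.eval_prod, Finset.prod_ne_zero_iff]
    intro m hm
    have : m ≠ n := Finset.ne_of_mem_erase hm
    simpa [sub_eq_zero] using this.symm
  have key : Polynomial.aeval (J k) p • x = (W.B.repr x n * p.eval (W.j + n)) • W.B n := by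
    conv_lhs => rw [← W.B.linearCombination_repr x, Finsupp.linearCombination_apply, Finsupp.sum,
      Finset.smul_sum]
    rw [Finset.sum_eq_single n]
    · rw [smul_comm, W.aeval_J_smul, smul_smul]
    · intro m hm hmn
      have : p.eval (W.j + m) = 0 := by
        rw [Polynomial.eval_prod]
        exact Finset.prod_eq_zero (Finset.mem_erase.mpr ⟨hmn, hm⟩) (by simp)
      rw [smul_comm, W.aeval_J_smul, this, zero_smul, smul_zero]
    · intro h
      exact absurd (Finsupp.mem_support_iff.mpr hn) h
  have hmem := (P.restrictScalars ℂ).smul_mem (W.B.repr x n * p.eval (W.j + n))⁻¹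
    (show _ ∈ P.restrictScalars ℂ from P.smul_mem (Polynomial.aeval (J k) p) hx)
  rwa [key, inv_smul_smul₀ (mul_ne_zero hn hp)] at hmem

/-- The set `S` of indices is stable under the action of `G⁺` and `G⁻`. -/
def Closed (S : Set ℤ) : Prop :=
  ∀ n, (n ∈ S → W.a n ≠ 0 → n + 1 ∈ S) ∧ (n + 1 ∈ S → W.b n ≠ 0 → n ∈ S)

/-- The submodule spanned by the basis vectors with index in a stable set. -/
def sub (S : Set ℤ) (hS : W.Closed S) : Submodule (A k) M where
  __ := Submodule.span ℂ (W.B '' S)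
  smul_mem' c x hx := by
    have : SMulCommClass ℂ (A k) M := IsScalarTower.to_smulCommClass
    have gen : ∀ c : A k, (∀ n ∈ S, c • W.B n ∈ Submodule.span ℂ (W.B '' S)) →
        ∀ x ∈ Submodule.span ℂ (W.B '' S), c • x ∈ Submodule.span ℂ (W.B '' S) := by
      intro c hc x hx
      induction hx using Submodule.span_induction with
      | mem x hx => obtain ⟨n, hn, rfl⟩ := hx; exact hc n hn
      | zero => rw [smul_zero]; exact zero_mem _
      | add x y _ _ hx hy => rw [smul_add]; exact add_mem hx hy
      | smul r x _ hx => rw [smul_comm]; exact Submodule.smul_mem _ _ hx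
    have mem : ∀ n (c : ℂ), (c ≠ 0 → n ∈ S) → c • W.B n ∈ Submodule.span ℂ (W.B '' S) := by
      intro n c h
      by_cases hc : c = 0
      · rw [hc, zero_smul]; exact zero_mem _
      · exact Submodule.smul_mem _ _ (Submodule.subset_span ⟨n, h hc, rfl⟩)
    refine smul_mem_of_generators (k := k) _ (gen _ ?_) (gen _ ?_) (gen _ ?_) (gen _ ?_) c x hx
    · exact fun n hn => by rw [W.J_smul]; exact mem _ _ fun _ => hn
    · exact fun n hn => by rw [W.Gp_smul]; exact mem _ _ ((hS n).1 hn)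
    · intro n hn
      obtain ⟨n, rfl⟩ : ∃ m, n = m + 1 := ⟨n - 1, by ring⟩
      rw [W.Gm_smul]
      exact mem _ _ ((hS n).2 hn)
    · exact fun n hn => by rw [W.L_smul]; exact mem _ _ fun _ => hn

lemma mem_sub_iff {S : Set ℤ} {hS : W.Closed S} {x : M} :
    x ∈ W.sub S hS ↔ ∀ n, W.B.repr x n ≠ 0 → n ∈ S := by
  change x ∈ Submodule.span ℂ (W.B '' S) ↔ _
  rw [Module.Basis.mem_span_image]
  simp [Set.subset_def]

lemma basis_mem_sub_iff {S : Set ℤ} {hS : W.Closed S} {n : ℤ} :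
    W.B n ∈ W.sub S hS ↔ n ∈ S := by
  simp [mem_sub_iff, Finsupp.single_apply]

lemma sub_le_iff {S : Set ℤ} {hS : W.Closed S} {P : Submodule (A k) M} :
    W.sub S hS ≤ P ↔ ∀ n ∈ S, W.B n ∈ P := by
  refine ⟨fun h n hn => h (W.basis_mem_sub_iff.mpr hn), fun h x hx => ?_⟩
  have : Submodule.span ℂ (W.B '' S) ≤ P.restrictScalars ℂ := by
    rw [Submodule.span_le]
    rintro _ ⟨n, hn, rfl⟩
    exact h n hn
  exact this hx

lemma basis_mem_iff_of_ne_zero {P : Submodule (A k) M} {n : ℤ} (ha : W.a n ≠ 0)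
    (hb : W.b n ≠ 0) : W.B (n + 1) ∈ P ↔ W.B n ∈ P := by
  constructor <;> intro h
  · have := (P.restrictScalars ℂ).smul_mem (W.b n)⁻¹
      (show _ ∈ P.restrictScalars ℂ from P.smul_mem (Gm k) h)
    rwa [W.Gm_smul, inv_smul_smul₀ hb] at this
  · have := (P.restrictScalars ℂ).smul_mem (W.a n)⁻¹
      (show _ ∈ P.restrictScalars ℂ from P.smul_mem (Gp k) h)
    rwa [W.Gp_smul, inv_smul_smul₀ ha] at this

lemma basis_mem_iff_of_le {P : Submodule (A k) M} {m n : ℤ} (hmn : m ≤ n)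
    (h : ∀ t, m ≤ t → t < n → W.a t ≠ 0 ∧ W.b t ≠ 0) : W.B n ∈ P ↔ W.B m ∈ P := by
  induction n, hmn using Int.leInduction with
  | base => rfl
  | succ n hmn ih =>
    obtain ⟨ha, hb⟩ := h n hmn (by omega)
    rw [W.basis_mem_iff_of_ne_zero ha hb]
    exact ih fun t h₁ h₂ => h t h₁ (by omega)

section Factors

variable {S T : Set ℤ} {hS : W.Closed S} {hT : W.Closed T}

/-- The image of a basis vector in a factor module. -/
def factorVec (hS : W.Closed S) (hT : W.Closed T) {n : ℤ} (hn : n ∈ T) :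
    factorModule k (W.sub S hS) (W.sub T hT) :=
  Submodule.Quotient.mk ⟨W.B n, W.basis_mem_sub_iff.mpr hn⟩

lemma smul_factorVec_eq {n : ℤ} (hn : n ∈ T) {c : A k} {r : ℂ} (h : c • W.B n = r • W.B n) :
    c • W.factorVec hS hT hn = r • W.factorVec hS hT hn := by
  rw [factorVec, ← Submodule.Quotient.mk_smul, ← Submodule.Quotient.mk_smul]
  exact congrArg _ (Subtype.ext h)

lemma factorVec_eq_zero_iff {n : ℤ} (hn : n ∈ T) : W.factorVec hS hT hn = 0 ↔ n ∈ S := by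
  rw [factorVec, Submodule.Quotient.mk_eq_zero, Submodule.mem_comap]
  exact W.basis_mem_sub_iff

lemma smul_factorVec_eq_zero {n m : ℤ} (hn : n ∈ T) {c : A k} {r : ℂ}
    (h : c • W.B n = r • W.B m) (hm : m ∈ T → m ∈ S) : c • W.factorVec hS hT hn = 0 := by
  rw [factorVec, ← Submodule.Quotient.mk_smul, Submodule.Quotient.mk_eq_zero,
    Submodule.mem_comap]
  have hmem : c • W.B n ∈ W.sub T hT := Submodule.smul_mem _ _ (W.basis_mem_sub_iff.mpr hn)
  change c • W.B n ∈ W.sub S hS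
  rw [h] at hmem ⊢
  by_cases hr : r = 0
  · rw [hr, zero_smul]; exact zero_mem _
  · have := (W.mem_sub_iff.mp hmem) m (by simpa using hr)
    exact ((W.sub S hS).restrictScalars ℂ).smul_mem _
      (W.basis_mem_sub_iff (hS := hS).mpr (hm this))

lemma isHWModule_factor (hcov : W.sub S hS ⋖ W.sub T hT) (hle : S ⊆ T) {n : ℤ} (hn : n ∈ T)
    (hnS : n ∉ S) (hm : n + 1 ∈ T → n + 1 ∈ S) :
    IsHWModule k (factorModule k (W.sub S hS) (W.sub T hT)) := by
  have hne : W.factorVec hS hT hn ≠ 0 := mt (W.factorVec_eq_zero_iff hn).mp hnS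
  have := (covBy_iff_quot_is_simple (W.sub_le_iff.mpr fun n hn =>
    W.basis_mem_sub_iff.mpr (hle hn))).mp hcov
  refine ⟨W.factorVec hS hT hn, W.j + n, W.Δ, hne, ?_, ?_,
    W.smul_factorVec_eq_zero hn (W.Gp_smul n) hm, IsSimpleModule.span_singleton_eq_top _ hne⟩
  · rw [algebraMap_smul]; exact W.smul_factorVec_eq hn (W.J_smul n)
  · rw [algebraMap_smul]; exact W.smul_factorVec_eq hn (W.L_smul n)

lemma isLWModule_factor (hcov : W.sub S hS ⋖ W.sub T hT) (hle : S ⊆ T) {n : ℤ} (hn : n + 1 ∈ T)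
    (hnS : n + 1 ∉ S) (hm : n ∈ T → n ∈ S) :
    IsLWModule k (factorModule k (W.sub S hS) (W.sub T hT)) := by
  have hne : W.factorVec hS hT hn ≠ 0 := mt (W.factorVec_eq_zero_iff hn).mp hnS
  have := (covBy_iff_quot_is_simple (W.sub_le_iff.mpr fun n hn =>
    W.basis_mem_sub_iff.mpr (hle hn))).mp hcov
  refine ⟨W.factorVec hS hT hn, W.j + (n + 1 : ℤ), W.Δ, hne, ?_, ?_,
    W.smul_factorVec_eq_zero hn (W.Gm_smul n) hm, IsSimpleModule.span_singleton_eq_top _ hne⟩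
  · rw [algebraMap_smul]; exact W.smul_factorVec_eq hn (W.J_smul _)
  · rw [algebraMap_smul]; exact W.smul_factorVec_eq hn (W.L_smul _)

lemma finDimOverC_factor (h : (T \ S).Finite) :
    FinDimOverC k (factorModule k (W.sub S hS) (W.sub T hT)) := by
  rw [finDimOverC_iff]
  have := h.to_subtype
  set F := Submodule.span ℂ (Set.range fun n : ↥(T \ S) => W.factorVec hS hT n.2.1)
  suffices hF : F = ⊤ from ⟨hF ▸ Submodule.fg_span (Set.finite_range _)⟩
  rw [eq_top_iff]
  rintro y -
  obtain ⟨⟨x, hx⟩, rfl⟩ := Submodule.Quotient.mk_surjective _ y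
  change x ∈ Submodule.span ℂ (W.B '' T) at hx
  induction hx using Submodule.span_induction with
  | mem x hx' =>
    obtain ⟨n, hn, rfl⟩ := hx'
    change W.factorVec hS hT hn ∈ F
    by_cases hnS : n ∈ S
    · rw [(W.factorVec_eq_zero_iff hn).mpr hnS]; exact zero_mem _
    · exact Submodule.subset_span ⟨⟨n, hn, hnS⟩, rfl⟩
  | zero => exact F.zero_mem
  | add x y _ _ ihx ihy => exact F.add_mem ihx ihy
  | smul r x _ ih => exact F.smul_mem r ih

lemma not_finDimOverC_factor (h : (T \ S).Infinite) :
    ¬ FinDimOverC k (factorModule k (W.sub S hS) (W.sub T hT)) := by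
  rw [finDimOverC_iff]
  intro hfin
  have := h.to_subtype
  have hli := Module.End.eigenvectors_linearIndependent'
    (Algebra.lsmul ℂ ℂ (factorModule k (W.sub S hS) (W.sub T hT)) (J k))
    (fun n : ↥(T \ S) => W.j + ((n : ℤ) : ℂ))
    (fun m n hmn => Subtype.ext (by simpa using hmn))
    (fun n => W.factorVec hS hT n.2.1)
    (fun n => ⟨Module.End.mem_eigenspace_iff.mpr (W.smul_factorVec_eq n.2.1 (W.J_smul n)),
      mt (W.factorVec_eq_zero_iff n.2.1).mp n.2.2⟩)
  exact not_finite_iff_infinite.mpr this hli.finite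

end Factors

section Series

variable (N : Finset ℤ) (ha : ∀ n, W.a n = 0 ↔ n ∈ N ∧ n < 0)
  (hb : ∀ n, W.b n = 0 ↔ n ∈ N ∧ 0 ≤ n)

include ha hb

omit [IsScalarTower ℂ (A k) M] in
lemma closed_level_lt (i : ℕ) : W.Closed {n | level N n < i} := fun n =>
  ⟨fun h h' => (level_succ_le (mt (ha n).mpr h')).trans_lt h,
    fun h h' => (level_le_succ (mt (hb n).mpr h')).trans_lt h⟩

/-- The members of the composition series. -/
def filtration (i : ℕ) : Submodule (A k) M :=
  W.sub {n | level N n < i} (W.closed_level_lt N ha hb i)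

lemma basis_mem_iff_of_rank_eq {P : Submodule (A k) M} {m n : ℤ} (h : rank N m = rank N n) :
    W.B m ∈ P ↔ W.B n ∈ P := by
  wlog hmn : m ≤ n generalizing m n
  · exact (this h.symm (le_of_not_ge hmn)).symm
  · refine (W.basis_mem_iff_of_le hmn fun t h₁ h₂ => ?_).symm
    have := notMem_of_rank_eq h h₁ h₂
    exact ⟨fun h' => this ((ha t).mp h').1, fun h' => this ((hb t).mp h').1⟩

lemma filtration_covBy {i : ℕ} (hi : i < N.card + 1) :
    W.filtration N ha hb i ⋖ W.filtration N ha hb (i + 1) := by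
  have hle : W.filtration N ha hb i ≤ W.filtration N ha hb (i + 1) :=
    W.sub_le_iff.mpr fun n hn => W.basis_mem_sub_iff.mpr (Nat.lt_succ_of_lt hn)
  obtain ⟨n, hn⟩ := exists_level_eq N hi
  refine ⟨lt_of_le_not_ge hle fun h => ?_, fun P h₁ h₂ => h₂.not_ge ?_⟩
  · have : level N n < i := W.basis_mem_sub_iff.mp
      (h (W.basis_mem_sub_iff.mpr (show level N n < i + 1 by omega)))
    omega
  · obtain ⟨x, hx, hx'⟩ := Set.exists_of_ssubset h₁
    rw [filtration, SetLike.mem_coe, W.mem_sub_iff] at hx'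
    push Not at hx'
    obtain ⟨t, ht, hti⟩ := hx'
    have htP := W.basis_mem_of_mem hx ht
    have hti' : level N t < i + 1 := W.mem_sub_iff.mp (h₂.le hx) t ht
    have hti : ¬ level N t < i := hti
    refine W.sub_le_iff.mpr fun m hm => ?_
    have hm : level N m < i + 1 := hm
    by_cases hmi : level N m < i
    · exact h₁.le (W.basis_mem_sub_iff.mpr hmi)
    · exact (W.basis_mem_iff_of_rank_eq N ha hb ((level_eq_iff N m t).mp (by omega))).mpr htP

lemma exists_compositionSeries :
    ∃ s : CompositionSeries (Submodule (A k) M),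
      s.head = ⊥ ∧ s.last = ⊤ ∧ s.length = N.card + 1 ∧
      (¬ IsSimpleModule (A k) M →
        ∃ i₁ i₂ : Fin s.length, i₁ ≠ i₂ ∧
          IsHWModule k (factorModule k (s i₁.castSucc) (s i₁.succ)) ∧
          ¬ FinDimOverC k (factorModule k (s i₁.castSucc) (s i₁.succ)) ∧
          IsLWModule k (factorModule k (s i₂.castSucc) (s i₂.succ)) ∧
          ¬ FinDimOverC k (factorModule k (s i₂.castSucc) (s i₂.succ)) ∧
          ∀ i : Fin s.length, i ≠ i₁ → i ≠ i₂ →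
            FinDimOverC k (factorModule k (s i.castSucc) (s i.succ))) := by
  have hbot : W.filtration N ha hb 0 = ⊥ :=
    eq_bot_iff.mpr (W.sub_le_iff.mpr fun n hn => absurd hn (Nat.not_lt_zero _))
  have htop : W.filtration N ha hb (N.card + 1) = ⊤ :=
    eq_top_iff.mpr fun x _ => W.mem_sub_iff.mpr fun n _ => level_lt N n
  have hcl := W.closed_level_lt N ha hb
  have hcov := fun i : Fin (N.card + 1) => W.filtration_covBy N ha hb i.2
  refine ⟨⟨N.card + 1, fun i => W.filtration N ha hb i, hcov⟩, hbot, htop, rfl, fun hns => ?_⟩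
  have hne : N.Nonempty := by
    rw [Finset.nonempty_iff_ne_empty]
    rintro rfl
    have := hcov 0
    simp only [Fin.val_zero, hbot] at this
    rw [show 0 + 1 = (∅ : Finset ℤ).card + 1 from rfl, htop] at this
    exact hns ((isSimpleModule_iff _ _).mpr (isSimpleOrder_iff_isAtom_top.mpr (bot_covBy_iff.mp this)))
  set p := N.min' hne
  set q := N.max' hne
  have hp : ∀ n ≤ p, rank N n = 0 := fun n hn =>
    rank_eq_zero_of_forall_le fun x hx => hn.trans (N.min'_le x hx)
  have hq : ∀ n, q < n → rank N n = N.card := fun n hn =>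
    rank_eq_card_of_forall_lt fun x hx => (N.le_max' x hx).trans_lt hn
  have hcard : 0 < N.card := hne.card_pos
  have hp1 : rank N (p + 1) = rank N p + 1 := rank_succ_of_mem (N.min'_mem hne)
  have hq1 : rank N (q + 1) = rank N q + 1 := rank_succ_of_mem (N.max'_mem hne)
  have hsub : ∀ i : ℕ, {n | level N n < i} ⊆ {n | level N n < i + 1} :=
    fun i n hn => Nat.lt_succ_of_lt hn
  have hlev : ∀ m n, rank N m = rank N n → level N m = level N n :=
    fun m n => (level_eq_iff N m n).mpr
  have hlev' : ∀ m n, rank N m ≠ rank N n → level N m ≠ level N n :=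
    fun m n => mt (level_eq_iff N m n).mp
  refine ⟨⟨level N p, level_lt N p⟩, ⟨level N (q + 1), level_lt N _⟩, ?_, ?_, ?_, ?_, ?_, ?_⟩
  · intro h
    have h1 := (level_eq_iff N _ _).mp (Fin.mk.inj_iff.mp h)
    rw [hp p le_rfl, hq (q + 1) (by omega)] at h1
    omega
  · refine W.isHWModule_factor (hcov ⟨level N p, level_lt N p⟩) (hsub _) (n := p)
      (Nat.lt_succ_self _) (lt_irrefl (level N p)) ?_
    have := hlev' (p + 1) p (by omega)
    simp only [Set.mem_ofPred_eq, Fin.val_succ, Fin.val_castSucc]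
    omega
  · refine W.not_finDimOverC_factor (hS := hcl _) (hT := hcl _) ((Set.Iic_infinite p).mono fun n hn => ?_)
    have := hlev n p (by rw [hp n hn, hp p le_rfl])
    simp [this]
  · refine W.isLWModule_factor (hcov ⟨level N (q + 1), level_lt N _⟩) (hsub _) (n := q)
      (Nat.lt_succ_self _) (lt_irrefl (level N (q + 1))) ?_
    have := hlev' (q + 1) q (by omega)
    simp only [Set.mem_ofPred_eq, Fin.val_succ, Fin.val_castSucc]
    omega
  · refine W.not_finDimOverC_factor (hS := hcl _) (hT := hcl _) ((Set.Ioi_infinite q).mono fun n hn => ?_)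
    have := hlev n (q + 1) (by rw [hq n hn, hq (q + 1) (by omega)])
    simp [this]
  · rintro ⟨i, hi⟩ hi₁ hi₂
    refine W.finDimOverC_factor (hS := hcl _) (hT := hcl _) ((Set.finite_Ioc p q).subset ?_)
    rintro n ⟨hn₁, hn₂⟩
    simp only [Set.mem_ofPred_eq, Fin.val_succ, Fin.val_castSucc] at hn₁ hn₂
    have hni : level N n = i := by omega
    rw [ne_eq, Fin.mk.injEq] at hi₁ hi₂
    constructor
    · by_contra! h
      exact hi₁ (hni ▸ hlev n p (by rw [hp n h, hp p le_rfl]))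
    · by_contra! h
      exact hi₂ (hni ▸ hlev n (q + 1) (by rw [hq n h, hq (q + 1) (by omega)]))

end Series

end WeightBasis

section Realisation

variable (k j Δ ω : ℂ)

/-- The eigenvalue of `G⁻G⁺` on vectors of weight `x`. -/
def gmgp (x : ℂ) : ℂ := (ω - omegaP k x Δ) / 2

lemma gmgp_sub (x : ℂ) : gmgp k Δ ω x - gmgp k Δ ω (x + 1) =
    3 * (x + 1) ^ 2 - (k + 3) * Δ - 1/8 * (k + 1) * (2*k + 3) := by
  unfold gmgp omegaP
  ring

/-- The matrix coefficient of `G⁺` from weight `j + n` to weight `j + n + 1`. -/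
def upCoeff (n : ℤ) : ℂ := if n < 0 then gmgp k Δ ω (j + n) else 1

/-- The matrix coefficient of `G⁻` from weight `j + n + 1` to weight `j + n`. -/
def downCoeff (n : ℤ) : ℂ := if n < 0 then 1 else gmgp k Δ ω (j + n)

lemma upCoeff_mul_downCoeff (n : ℤ) :
    upCoeff k j Δ ω n * downCoeff k j Δ ω n = gmgp k Δ ω (j + n) := by
  unfold upCoeff downCoeff
  split_ifs <;> simp

/-- `J` acting on `ℤ →₀ ℂ`. -/
def opJ : Module.End ℂ (ℤ →₀ ℂ) :=
  Finsupp.linearCombination ℂ fun n : ℤ => Finsupp.single n (j + n)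

/-- `G⁺` acting on `ℤ →₀ ℂ`. -/
def opGp : Module.End ℂ (ℤ →₀ ℂ) :=
  Finsupp.linearCombination ℂ fun n : ℤ => Finsupp.single (n + 1) (upCoeff k j Δ ω n)

/-- `G⁻` acting on `ℤ →₀ ℂ`. -/
def opGm : Module.End ℂ (ℤ →₀ ℂ) :=
  Finsupp.linearCombination ℂ fun n : ℤ => Finsupp.single (n - 1) (downCoeff k j Δ ω (n - 1))

lemma opJ_single (n : ℤ) (c : ℂ) : opJ j (Finsupp.single n c) = Finsupp.single n (c * (j + n)) := by
  rw [opJ, Finsupp.linearCombination_single, Finsupp.smul_single, smul_eq_mul]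

lemma opGp_single (n : ℤ) (c : ℂ) : opGp k j Δ ω (Finsupp.single n c) =
    Finsupp.single (n + 1) (c * upCoeff k j Δ ω n) := by
  simp [opGp]

lemma opGm_single (n : ℤ) (c : ℂ) : opGm k j Δ ω (Finsupp.single n c) =
    Finsupp.single (n - 1) (c * downCoeff k j Δ ω (n - 1)) := by
  simp [opGm]

lemma opGp_opGm_single (n : ℤ) (c : ℂ) : opGp k j Δ ω (opGm k j Δ ω (Finsupp.single n c)) =
    Finsupp.single n (c * gmgp k Δ ω (j + n - 1)) := by
  rw [opGm_single, opGp_single, sub_add_cancel, mul_assoc, mul_comm (downCoeff _ _ _ _ _),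
    upCoeff_mul_downCoeff]
  push_cast
  rw [add_sub_assoc]

lemma opGm_opGp_single (n : ℤ) (c : ℂ) : opGm k j Δ ω (opGp k j Δ ω (Finsupp.single n c)) =
    Finsupp.single n (c * gmgp k Δ ω (j + n)) := by
  rw [opGp_single, opGm_single, add_sub_cancel_right, mul_assoc, upCoeff_mul_downCoeff]

/-- The representation of the free algebra on `ℤ →₀ ℂ`. -/
def freeRep : F →ₐ[ℂ] Module.End ℂ (ℤ →₀ ℂ) :=
  FreeAlgebra.lift ℂ ![opJ j, opGp k j Δ ω, opGm k j Δ ω, algebraMap ℂ _ Δ]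

lemma freeRep_jF : freeRep k j Δ ω jF = opJ j := by simp [freeRep, jF]

lemma freeRep_gpF : freeRep k j Δ ω gpF = opGp k j Δ ω := by simp [freeRep, gpF]

lemma freeRep_gmF : freeRep k j Δ ω gmF = opGm k j Δ ω := by simp [freeRep, gmF]

lemma freeRep_lF : freeRep k j Δ ω lF = algebraMap ℂ _ Δ := by simp [freeRep, lF]

lemma freeRep_rel {x y : F} (h : Rel k x y) : freeRep k j Δ ω x = freeRep k j Δ ω y := by
  cases h with
  | lj => rw [map_mul, map_mul, freeRep_lF, Algebra.commutes]
  | lgp => rw [map_mul, map_mul, freeRep_lF, Algebra.commutes]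
  | lgm => rw [map_mul, map_mul, freeRep_lF, Algebra.commutes]
  | jgp =>
    simp only [map_sub, map_mul, freeRep_jF, freeRep_gpF]
    refine Finsupp.lhom_ext fun n c => ?_
    simp only [LinearMap.sub_apply, Module.End.mul_apply, opJ_single, opGp_single]
    rw [← Finsupp.single_sub]
    congr 1
    push_cast
    ring
  | jgm =>
    simp only [map_sub, map_mul, map_neg, freeRep_jF, freeRep_gmF]
    refine Finsupp.lhom_ext fun n c => ?_
    simp only [LinearMap.sub_apply, LinearMap.neg_apply, Module.End.mul_apply, opJ_single,
      opGm_single]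
    rw [← Finsupp.single_sub, ← Finsupp.single_neg]
    congr 1
    push_cast
    ring
  | gpgm =>
    rw [fF, map_sub, map_sub, map_sub, map_mul, map_mul, map_mul, map_mul, map_pow,
      AlgHom.commutes, AlgHom.commutes, map_ofNat, freeRep_jF, freeRep_gpF, freeRep_gmF,
      freeRep_lF, ← map_mul, ← map_ofNat (algebraMap ℂ (Module.End ℂ (ℤ →₀ ℂ))) 3]
    refine Finsupp.lhom_ext fun n c => ?_
    have := gmgp_sub k Δ ω (j + n - 1)
    rw [sub_add_cancel] at this
    simp only [LinearMap.sub_apply, Module.End.mul_apply, opGp_opGm_single, opGm_opGp_single,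
      Module.algebraMap_end_apply, pow_two, opJ_single, Finsupp.smul_single, smul_eq_mul]
    simp only [← Finsupp.single_sub]
    congr 1
    linear_combination c * this

/-- The representation of `A_k` on `ℤ →₀ ℂ`. -/
def rep : A k →ₐ[ℂ] Module.End ℂ (ℤ →₀ ℂ) :=
  RingQuot.liftAlgHom ℂ ⟨freeRep k j Δ ω, fun _ _ h => freeRep_rel k j Δ ω h⟩

lemma rep_mk (x : F) : rep k j Δ ω (mk k x) = freeRep k j Δ ω x :=
  RingQuot.liftAlgHom_mkAlgHom_apply _ _ _ _

lemma rep_J : rep k j Δ ω (J k) = opJ j := by rw [J, rep_mk, freeRep_jF]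

lemma rep_Gp : rep k j Δ ω (Gp k) = opGp k j Δ ω := by rw [Gp, rep_mk, freeRep_gpF]

lemma rep_Gm : rep k j Δ ω (Gm k) = opGm k j Δ ω := by rw [Gm, rep_mk, freeRep_gmF]

lemma rep_L : rep k j Δ ω (L k) = algebraMap ℂ _ Δ := by rw [L, rep_mk, freeRep_lF]

lemma rep_Omega_single (c : ℂ) :
    rep k j Δ ω (Omega k) (Finsupp.single 0 c) = Finsupp.single 0 (c * ω) := by
  rw [Omega, map_sub, map_add, map_add, map_add, map_mul, map_mul, map_mul, map_mul, map_mul,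
    map_pow, map_add, map_mul, AlgHom.commutes, AlgHom.commutes, map_ofNat, rep_J, rep_Gp, rep_Gm,
    rep_L, ← map_mul, ← map_add, ← map_ofNat (algebraMap ℂ (Module.End ℂ (ℤ →₀ ℂ))) 2]
  have := gmgp_sub k Δ ω (j - 1)
  rw [sub_add_cancel] at this
  have h' : gmgp k Δ ω j * 2 = ω - omegaP k j Δ := by unfold gmgp; ring
  unfold omegaP at h'
  simp only [LinearMap.sub_apply, LinearMap.add_apply, Module.End.mul_apply, opGp_opGm_single,
    opGm_opGp_single, Module.algebraMap_end_apply, pow_succ, pow_zero, one_mul, opJ_single,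
    Finsupp.smul_single, smul_eq_mul, Int.cast_zero, add_zero]
  simp only [← Finsupp.single_sub, ← Finsupp.single_add]
  congr 1
  linear_combination c * this + c * h'

lemma rep_eq_zero_of_mem {x : A k} (hx : x ∈ denseIdeal k j Δ ω) :
    rep k j Δ ω x (Finsupp.single 0 1) = 0 := by
  induction hx using Submodule.span_induction with
  | mem x hx =>
    rcases hx with rfl | rfl | rfl
    · rw [map_sub, AlgHom.commutes, rep_J, LinearMap.sub_apply, opJ_single]
      simp
    · rw [map_sub, AlgHom.commutes, rep_L, sub_self, LinearMap.zero_apply]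
    · rw [map_sub, AlgHom.commutes, LinearMap.sub_apply, rep_Omega_single]
      simp
  | zero => rw [map_zero, LinearMap.zero_apply]
  | add x y _ _ hx hy => rw [map_add, LinearMap.add_apply, hx, hy, add_zero]
  | smul a x _ hx => rw [smul_eq_mul, map_mul, Module.End.mul_apply, hx, map_zero]

/-- Representatives in `A_k` of the weight vectors of `R_{j,Δ,ω}`. -/
def weightElt : ℤ → A k
  | .ofNat n => Gp k ^ n
  | .negSucc n => Gm k ^ (n + 1)

lemma Gp_mul_weightElt {n : ℤ} (hn : 0 ≤ n) :
    Gp k * weightElt k n = weightElt k (n + 1) := by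
  obtain ⟨n, rfl⟩ := Int.eq_ofNat_of_zero_le hn
  exact (pow_succ' _ _).symm

lemma Gm_mul_weightElt {n : ℤ} (hn : n < 0) :
    Gm k * weightElt k (n + 1) = weightElt k n := by
  obtain ⟨n, rfl⟩ := Int.eq_negSucc_of_lt_zero hn
  rcases n with _ | n
  · change Gm k * Gp k ^ 0 = Gm k ^ (0 + 1)
    simp
  · exact (pow_succ' _ _).symm

lemma rep_weightElt (n : ℤ) :
    rep k j Δ ω (weightElt k n) (Finsupp.single 0 1) = Finsupp.single n 1 := by
  induction n using Int.induction_on with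
  | zero =>
    change rep k j Δ ω (Gp k ^ 0) _ = _
    simp
  | succ n ih =>
    rw [← Gp_mul_weightElt k (by omega), map_mul, Module.End.mul_apply, ih, rep_Gp, opGp_single,
      upCoeff, if_neg (by omega), one_mul]
  | pred n ih =>
    rw [← Gm_mul_weightElt k (by omega), sub_add_cancel, map_mul, Module.End.mul_apply, ih, rep_Gm,
      opGm_single, downCoeff, if_pos (by omega), one_mul]

/-- The weight vectors of `R_{j,Δ,ω}`. -/
def weightVec (n : ℤ) : Rmod k j Δ ω := weightElt k n • rv k j Δ ω

lemma weightVec_eq_mk (n : ℤ) :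
    weightVec k j Δ ω n = Submodule.Quotient.mk (weightElt k n) := by
  rw [weightVec, rv, ← Submodule.Quotient.mk_smul, smul_eq_mul, mul_one]

lemma weightVec_zero : weightVec k j Δ ω 0 = rv k j Δ ω := by
  change (Gp k ^ 0) • _ = _
  rw [pow_zero, one_smul]

lemma Gp_smul_weightVec_of_nonneg {n : ℤ} (hn : 0 ≤ n) :
    Gp k • weightVec k j Δ ω n = weightVec k j Δ ω (n + 1) := by
  rw [weightVec, smul_smul, Gp_mul_weightElt k hn, weightVec]

lemma Gm_smul_weightVec_of_neg {n : ℤ} (hn : n < 0) :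
    Gm k • weightVec k j Δ ω (n + 1) = weightVec k j Δ ω n := by
  rw [weightVec, smul_smul, Gm_mul_weightElt k hn, weightVec]

lemma sub_smul_rv {x : A k} {c : ℂ} (h : x - algebraMap ℂ (A k) c ∈ denseIdeal k j Δ ω) :
    x • rv k j Δ ω = c • rv k j Δ ω := by
  rw [← algebraMap_smul (A k) c, ← sub_eq_zero, ← sub_smul, rv, ← Submodule.Quotient.mk_smul,
    smul_eq_mul, mul_one]
  exact (Submodule.Quotient.mk_eq_zero _).mpr h

lemma J_smul_weightVec (n : ℤ) :
    J k • weightVec k j Δ ω n = (j + n) • weightVec k j Δ ω n := by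
  induction n using Int.induction_on with
  | zero =>
    rw [weightVec_zero, Int.cast_zero, add_zero]
    exact sub_smul_rv k j Δ ω (Submodule.subset_span (by simp))
  | succ n ih =>
    rw [← Gp_smul_weightVec_of_nonneg k j Δ ω (by omega), smul_smul, J_mul_Gp, add_smul, mul_smul,
      ih, smul_comm (Gp k) (_ : ℂ)]
    push_cast
    rw [← add_assoc, add_smul _ (1 : ℂ), one_smul]
  | pred n ih =>
    rw [← Gm_smul_weightVec_of_neg k j Δ ω (by omega), sub_add_cancel, smul_smul, J_mul_Gm,
      sub_smul, mul_smul, ih, smul_comm (Gm k) (_ : ℂ)]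
    push_cast
    rw [← add_sub_assoc, sub_smul _ (1 : ℂ), one_smul]

lemma L_smul_weightVec (n : ℤ) :
    L k • weightVec k j Δ ω n = Δ • weightVec k j Δ ω n := by
  induction n using Int.induction_on with
  | zero =>
    rw [weightVec_zero]
    exact sub_smul_rv k j Δ ω (Submodule.subset_span (by simp))
  | succ n ih =>
    rw [← Gp_smul_weightVec_of_nonneg k j Δ ω (by omega), smul_smul, L_mul_Gp, mul_smul,
      ih, smul_comm (Gp k) (_ : ℂ)]
  | pred n ih =>
    rw [← Gm_smul_weightVec_of_neg k j Δ ω (by omega), sub_add_cancel, smul_smul, L_mul_Gm,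
      mul_smul, ih, smul_comm (Gm k) (_ : ℂ)]

lemma commutator_smul_weightVec (n : ℤ) :
    Gp k • Gm k • weightVec k j Δ ω n - Gm k • Gp k • weightVec k j Δ ω n =
      (gmgp k Δ ω (j + n - 1) - gmgp k Δ ω (j + n)) • weightVec k j Δ ω n := by
  have h := gmgp_sub k Δ ω (j + n - 1)
  rw [sub_add_cancel] at h
  rw [smul_smul, smul_smul, ← sub_smul, Gp_mul_Gm, sub_smul, sub_smul, mul_smul, mul_smul,
    L_smul_weightVec, pow_two, mul_smul, J_smul_weightVec, smul_comm (J k) (_ : ℂ),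
    J_smul_weightVec, algebraMap_smul, algebraMap_smul, h,
    ← map_ofNat (algebraMap ℂ (A k)) 3, algebraMap_smul]
  module

lemma Gm_Gp_smul_rv : Gm k • Gp k • rv k j Δ ω = gmgp k Δ ω j • rv k j Δ ω := by
  have hΩ : Omega k • rv k j Δ ω = ω • rv k j Δ ω :=
    sub_smul_rv k j Δ ω (Submodule.subset_span (by simp))
  have hc := commutator_smul_weightVec k j Δ ω 0
  have hJ := J_smul_weightVec k j Δ ω 0
  have hL := L_smul_weightVec k j Δ ω 0
  rw [weightVec_zero, Int.cast_zero, add_zero] at hc hJ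
  rw [weightVec_zero] at hL
  have h := gmgp_sub k Δ ω (j - 1)
  rw [sub_add_cancel] at h
  rw [h] at hc
  have h' : gmgp k Δ ω j = (ω - omegaP k j Δ) / 2 := rfl
  simp only [Omega, sub_smul, add_smul, mul_smul, pow_succ, pow_zero, one_smul, hL, hJ,
    ← map_ofNat (algebraMap ℂ (A k)) 2, algebraMap_smul, smul_add,
    smul_comm (J k) (_ : ℂ)] at hΩ
  rw [← sub_eq_zero] at hc hΩ ⊢
  rw [h', omegaP]
  generalize Gp k • Gm k • rv k j Δ ω = x at *
  generalize Gm k • Gp k • rv k j Δ ω = y at *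
  linear_combination (norm := module) (1/2 : ℂ) • hΩ - (1/2 : ℂ) • hc

lemma Gm_Gp_smul_weightVec (n : ℤ) : Gm k • Gp k • weightVec k j Δ ω n =
    gmgp k Δ ω (j + n) • weightVec k j Δ ω n := by
  induction n using Int.induction_on with
  | zero => rw [weightVec_zero, Int.cast_zero, add_zero, Gm_Gp_smul_rv]
  | succ n ih =>
    have hc := commutator_smul_weightVec k j Δ ω (n + 1)
    rw [← Gp_smul_weightVec_of_nonneg k j Δ ω (n := n) (by omega)] at hc ⊢
    rw [ih, smul_comm (Gp k) (_ : ℂ), sub_smul] at hc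
    push_cast at hc ⊢
    rw [show j + (n + 1) - 1 = j + (n : ℂ) by ring] at hc
    exact sub_right_inj.mp hc
  | pred n ih =>
    have hc := commutator_smul_weightVec k j Δ ω (-n)
    rw [ih, sub_smul, sub_left_inj] at hc
    have hv := Gm_smul_weightVec_of_neg k j Δ ω (n := -n - 1) (by omega)
    rw [sub_add_cancel] at hv
    rw [hv] at hc
    rw [hc, smul_comm (Gm k) (_ : ℂ), hv]
    push_cast
    rw [add_sub_assoc]

lemma Gp_smul_weightVec (n : ℤ) : Gp k • weightVec k j Δ ω n =
    upCoeff k j Δ ω n • weightVec k j Δ ω (n + 1) := by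
  unfold upCoeff
  split_ifs with h
  · have hc := commutator_smul_weightVec k j Δ ω (n + 1)
    rw [Gm_Gp_smul_weightVec, sub_smul, sub_left_inj, Gm_smul_weightVec_of_neg k j Δ ω h] at hc
    rw [hc]
    push_cast
    rw [← add_assoc, add_sub_cancel_right]
  · rw [one_smul, Gp_smul_weightVec_of_nonneg k j Δ ω (not_lt.mp h)]

lemma Gm_smul_weightVec (n : ℤ) : Gm k • weightVec k j Δ ω (n + 1) =
    downCoeff k j Δ ω n • weightVec k j Δ ω n := by
  unfold downCoeff
  split_ifs with h
  · rw [one_smul, Gm_smul_weightVec_of_neg k j Δ ω h]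
  · rw [← Gp_smul_weightVec_of_nonneg k j Δ ω (not_lt.mp h), Gm_Gp_smul_weightVec]

lemma linearIndependent_weightVec : LinearIndependent ℂ (weightVec k j Δ ω) := by
  rw [linearIndependent_iff]
  intro l hl
  have hl' : (Submodule.Quotient.mk (Finsupp.linearCombination ℂ (weightElt k) l) :
      Rmod k j Δ ω) = 0 := by
    rw [← hl, ← Submodule.mkQ_apply, ← LinearMap.coe_restrictScalars ℂ,
      Finsupp.apply_linearCombination]
    congr 2
    funext n
    exact (weightVec_eq_mk k j Δ ω n).symm
  have h := rep_eq_zero_of_mem k j Δ ω ((Submodule.Quotient.mk_eq_zero _).mp hl')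
  rw [Finsupp.linearCombination_apply, Finsupp.sum, map_sum, LinearMap.sum_apply] at h
  simp only [map_smul, LinearMap.smul_apply, rep_weightElt, Finsupp.smul_single, smul_eq_mul,
    mul_one] at h
  rw [← h]
  exact (Finsupp.sum_single l).symm

lemma top_le_span_weightVec : ⊤ ≤ Submodule.span ℂ (Set.range (weightVec k j Δ ω)) := by
  set P := Submodule.span ℂ (Set.range (weightVec k j Δ ω))
  have hv : ∀ (c : ℂ) n, c • weightVec k j Δ ω n ∈ P := fun c n =>
    P.smul_mem c (Submodule.subset_span ⟨n, rfl⟩)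
  have gen : ∀ c : A k, (∀ n, c • weightVec k j Δ ω n ∈ P) → ∀ x ∈ P, c • x ∈ P := by
    intro c hc x hx
    induction hx using Submodule.span_induction with
    | mem x hx => obtain ⟨n, rfl⟩ := hx; exact hc n
    | zero => rw [smul_zero]; exact P.zero_mem
    | add x y _ _ hx hy => rw [smul_add]; exact P.add_mem hx hy
    | smul r x _ hx => rw [smul_comm]; exact P.smul_mem _ hx
  rintro x -
  obtain ⟨c, rfl⟩ := Submodule.Quotient.mk_surjective _ x
  have hc : (Submodule.Quotient.mk c : Rmod k j Δ ω) = c • weightVec k j Δ ω 0 := by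
    rw [weightVec_zero, rv, ← Submodule.Quotient.mk_smul, smul_eq_mul, mul_one]
  rw [hc]
  refine smul_mem_of_generators P (gen _ fun n => ?_) (gen _ fun n => ?_) (gen _ fun n => ?_)
    (gen _ fun n => ?_) c _ (Submodule.subset_span ⟨0, rfl⟩)
  · rw [J_smul_weightVec]; exact hv _ _
  · rw [Gp_smul_weightVec]; exact hv _ _
  · rw [← sub_add_cancel n 1, Gm_smul_weightVec]; exact hv _ _
  · rw [L_smul_weightVec]; exact hv _ _

/-- The weight basis of `R_{j,Δ,ω}`. -/
def weightBasisRmod : WeightBasis k (Rmod k j Δ ω) where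
  B := Module.Basis.mk (linearIndependent_weightVec k j Δ ω) (top_le_span_weightVec k j Δ ω)
  a := upCoeff k j Δ ω
  b := downCoeff k j Δ ω
  j := j
  Δ := Δ
  J_smul n := by simp only [Module.Basis.mk_apply, J_smul_weightVec]
  L_smul n := by simp only [Module.Basis.mk_apply, L_smul_weightVec]
  Gp_smul n := by simp only [Module.Basis.mk_apply, Gp_smul_weightVec]
  Gm_smul n := by simp only [Module.Basis.mk_apply, Gm_smul_weightVec]

lemma exists_finset_gmgp_eq_zero :
    ∃ N : Finset ℤ, N.card ≤ 3 ∧ ∀ n : ℤ, n ∈ N ↔ gmgp k Δ ω (j + n) = 0 := by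
  set e := (k + 3) * Δ + 1/8 * (k + 1) * (2*k + 3)
  set P : Cubic ℂ := ⟨-2, -3, 2 * e - 1, ω + e⟩
  have hP : P.toPoly ≠ 0 := Cubic.ne_zero_of_a_ne_zero (by norm_num [P])
  have hroot : ∀ x, x ∈ P.toPoly.roots.toFinset ↔ gmgp k Δ ω x = 0 := by
    intro x
    rw [Multiset.mem_toFinset, Polynomial.mem_roots hP, Polynomial.IsRoot.def]
    have : P.toPoly.eval x = 2 * gmgp k Δ ω x := by
      simp only [P, e, Cubic.toPoly, gmgp, omegaP, Polynomial.eval_add, Polynomial.eval_mul,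
        Polynomial.eval_C, Polynomial.eval_pow, Polynomial.eval_X]
      ring
    rw [this, mul_eq_zero, or_iff_right two_ne_zero]
  have hinj : Function.Injective fun n : ℤ => j + (n : ℂ) := fun m n h => by simpa using h
  refine ⟨P.toPoly.roots.toFinset.preimage (fun n : ℤ => j + (n : ℂ)) hinj.injOn, ?_, fun n => ?_⟩
  · refine (Finset.card_le_card_of_injOn _ (fun n hn => Finset.mem_preimage.mp hn)
      hinj.injOn).trans ((Multiset.toFinset_card_le _).trans ((Polynomial.card_roots' _).trans ?_))
    exact (Cubic.natDegree_of_a_ne_zero (by norm_num [P])).le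
  · rw [Finset.mem_preimage, hroot]

lemma exists_weightBasis_Rmod :
    ∃ (W : WeightBasis k (Rmod k j Δ ω)) (N : Finset ℤ), N.card ≤ 3 ∧
      (∀ n, W.a n = 0 ↔ n ∈ N ∧ n < 0) ∧ ∀ n, W.b n = 0 ↔ n ∈ N ∧ 0 ≤ n := by
  obtain ⟨N, hN, h⟩ := exists_finset_gmgp_eq_zero k j Δ ω
  refine ⟨weightBasisRmod k j Δ ω, N, hN, fun n => ?_, fun n => ?_⟩
  · change upCoeff k j Δ ω n = 0 ↔ _
    rw [h]
    unfold upCoeff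
    split_ifs with hn <;> simp [hn]
  · change downCoeff k j Δ ω n = 0 ↔ _
    rw [h]
    unfold downCoeff
    split_ifs with hn
    · simp [hn]
    · simp [not_lt.mp hn]

end Realisation

/-- `R_{j,Δ,ω}` has finite length with at most four composition factors;
if it is not simple, then one composition factor is an infinite-dimensional highest-weight
module, another is an infinite-dimensional lowest-weight module, and all remaining
composition factors are finite-dimensional. -/
theorem dense_composition_series (k j Δ ω : ℂ) :
    ∃ s : CompositionSeries (Submodule (A k) (Rmod k j Δ ω)),
      s.head = ⊥ ∧ s.last = ⊤ ∧ s.length ≤ 4 ∧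
      (¬ IsSimpleModule (A k) (Rmod k j Δ ω) →
        ∃ i₁ i₂ : Fin s.length, i₁ ≠ i₂ ∧
          IsHWModule k (factorModule k (s i₁.castSucc) (s i₁.succ)) ∧
          ¬ FinDimOverC k (factorModule k (s i₁.castSucc) (s i₁.succ)) ∧
          IsLWModule k (factorModule k (s i₂.castSucc) (s i₂.succ)) ∧
          ¬ FinDimOverC k (factorModule k (s i₂.castSucc) (s i₂.succ)) ∧
          ∀ i : Fin s.length, i ≠ i₁ → i ≠ i₂ →
            FinDimOverC k (factorModule k (s i.castSucc) (s i.succ))) := by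
  obtain ⟨W, N, hN, ha, hb⟩ := exists_weightBasis_Rmod k j Δ ω
  obtain ⟨s, h₀, h₁, h₂, h₃⟩ := W.exists_compositionSeries N ha hb
  exact ⟨s, h₀, h₁, by omega, h₃⟩

end BP
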